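/- arXiv:1004.5355 — 2 statements merged into one kernel-verified Lean document; each statement's English description precedes it below -/
import Mathlib

section
/- Every discrete additive subgroup Λ of ℂ (a subgroup that is closed and all of whose points are isolated) is of exactly one of the following forms: (i) Λ = {0}; (ii) Λ = ℤω for some ω ≠ 0; (iii) Λ = ℤω₁ + ℤω₂ for some ω₁, ω₂ ∈ ℂ which are linearly independent over ℝ (equivalently ω₁/ω₂ ∉ ℝ). -/
/-- A subset of `ℂ` is discrete if it is closed and each of its points is isolated. -/
def IsDiscreteSubset (S : Set ℂ) : Prop :=
  IsClosed S ∧ ∀ z ∈ S, ∃ U ∈ nhds z, U ∩ S = {z}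

open Module Submodule in
/-- A discrete `ℤ`-submodule of a finite-dimensional real vector space is spanned over `ℤ` by a
finite family that is linearly independent over `ℝ`. -/
theorem exists_linearIndependent_span_int_eq_of_discrete {E : Type*} [NormedAddCommGroup E]
    [NormedSpace ℝ E] [FiniteDimensional ℝ E] (L : Submodule ℤ E) [DiscreteTopology L] :
    ∃ (n : ℕ) (v : Fin n → E), LinearIndependent ℝ v ∧ span ℤ (Set.range v) = L := by
  let b := finBasis ℤ L
  let v : Fin (finrank ℤ L) → E := fun i => (b i : E)
  have hspan : span ℤ (Set.range v) = L := by
    have hrange : Set.range v = L.subtype '' Set.range b := by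
      rw [← Set.range_comp]
      rfl
    rw [hrange, span_image, b.span_eq, Submodule.map_top, range_subtype]
  refine ⟨_, v, ?_, hspan⟩
  have hdisc : DiscreteTopology (span ℤ (Set.range v)) := by
    rw [hspan]
    infer_instance
  rw [linearIndependent_iff_card_eq_finrank_span, Real.finrank_eq_int_finrank_of_discrete hdisc,
    Set.finrank, hspan, Fintype.card_fin]

theorem IsDiscreteSubset.discreteTopology {S : Set ℂ} (hS : IsDiscreteSubset S) :
    DiscreteTopology S := by
  refine discreteTopology_subtype_iff'.mpr fun z hz => ?_
  obtain ⟨U, hU, hUS⟩ := hS.2 z hz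
  obtain ⟨V, hVU, hV, hzV⟩ := mem_nhds_iff.mp hU
  refine ⟨V, hV, Set.Subset.antisymm ?_ (Set.singleton_subset_iff.mpr ⟨hzV, hz⟩)⟩
  exact (Set.inter_subset_inter_left S hVU).trans hUS.subset

theorem LinearIndependent.div_ne_ofReal {v : Fin 2 → ℂ} (hv : LinearIndependent ℝ v) (r : ℝ) :
    v 0 / v 1 ≠ (r : ℂ) := by
  intro h
  rw [div_eq_iff (hv.ne_zero 1)] at h
  have hcoeff := Fintype.linearIndependent_iff.mp hv ![1, -r] (by simp [h]) 0
  simp at hcoeff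

/-- a discrete additive subgroup of `ℂ` is of exactly one of the forms:
trivial, `ℤω` with `ω ≠ 0`, or `ℤω₁ + ℤω₂` with `ω₁/ω₂ ∉ ℝ` (equivalently `ω₁, ω₂`
linearly independent over `ℝ`). -/
theorem discrete_subgroup_of_complex_trichotomy (Λ : AddSubgroup ℂ)
    (hdisc : IsDiscreteSubset (Λ : Set ℂ)) :
    ((Λ : Set ℂ) = {0} ∨
     (∃ ω : ℂ, ω ≠ 0 ∧ (Λ : Set ℂ) = {z | ∃ k : ℤ, z = (k : ℂ) * ω}) ∨
     (∃ ω₁ ω₂ : ℂ, (∀ r : ℝ, ω₁ / ω₂ ≠ (r : ℂ)) ∧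
        (Λ : Set ℂ) = {z | ∃ k₁ k₂ : ℤ, z = (k₁ : ℂ) * ω₁ + (k₂ : ℂ) * ω₂})) ∧
    ¬((Λ : Set ℂ) = {0} ∧
      (∃ ω : ℂ, ω ≠ 0 ∧ (Λ : Set ℂ) = {z | ∃ k : ℤ, z = (k : ℂ) * ω})) ∧
    ¬((Λ : Set ℂ) = {0} ∧
      (∃ ω₁ ω₂ : ℂ, (∀ r : ℝ, ω₁ / ω₂ ≠ (r : ℂ)) ∧
        (Λ : Set ℂ) = {z | ∃ k₁ k₂ : ℤ, z = (k₁ : ℂ) * ω₁ + (k₂ : ℂ) * ω₂})) ∧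
    ¬((∃ ω : ℂ, ω ≠ 0 ∧ (Λ : Set ℂ) = {z | ∃ k : ℤ, z = (k : ℂ) * ω}) ∧
      (∃ ω₁ ω₂ : ℂ, (∀ r : ℝ, ω₁ / ω₂ ≠ (r : ℂ)) ∧
        (Λ : Set ℂ) = {z | ∃ k₁ k₂ : ℤ, z = (k₁ : ℂ) * ω₁ + (k₂ : ℂ) * ω₂})) := by
  refine ⟨?_, ?_, ?_, ?_⟩
  · have : DiscreteTopology Λ.toIntSubmodule := hdisc.discreteTopology
    obtain ⟨n, v, hv, hspan⟩ := exists_linearIndependent_span_int_eq_of_discrete Λ.toIntSubmodule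
    have hmem (z : ℂ) : z ∈ (Λ : Set ℂ) ↔ ∃ c : Fin n → ℤ, ∑ i, c i • v i = z := by
      rw [← Submodule.mem_span_range_iff_exists_fun, hspan]
      rfl
    have hn : n ≤ 2 := by simpa using hv.fintype_card_le_finrank
    interval_cases n
    · refine Or.inl (Set.ext fun z => ?_)
      simp [hmem, eq_comm]
    · refine Or.inr (Or.inl ⟨v 0, hv.ne_zero 0, Set.ext fun z => ?_⟩)
      rw [hmem]
      constructor
      · rintro ⟨c, rfl⟩
        exact ⟨c 0, by simp⟩
      · rintro ⟨k, rfl⟩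
        exact ⟨![k], by simp⟩
    · refine Or.inr (Or.inr ⟨v 0, v 1, hv.div_ne_ofReal, Set.ext fun z => ?_⟩)
      rw [hmem]
      constructor
      · rintro ⟨c, rfl⟩
        exact ⟨c 0, c 1, by simp⟩
      · rintro ⟨k₁, k₂, rfl⟩
        exact ⟨![k₁, k₂], by simp⟩
  · rintro ⟨h₀, ω, hω, h₁⟩
    have hmem : ω ∈ ({0} : Set ℂ) := by
      rw [← h₀, h₁]
      exact ⟨1, by simp⟩
    exact hω hmem
  · rintro ⟨h₀, ω₁, ω₂, hω, h₂⟩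
    have hmem : ω₁ ∈ ({0} : Set ℂ) := by
      rw [← h₀, h₂]
      exact ⟨1, 0, by simp⟩
    exact hω 0 (by simp [Set.mem_singleton_iff.mp hmem])
  · rintro ⟨⟨ω, hω₀, h₁⟩, ω₁, ω₂, hω, h₂⟩
    rw [h₁] at h₂
    obtain ⟨k, rfl⟩ : ω₁ ∈ {z | ∃ k : ℤ, z = (k : ℂ) * ω} := by
      rw [h₂]
      exact ⟨1, 0, by simp⟩
    obtain ⟨l, rfl⟩ : ω₂ ∈ {z | ∃ k : ℤ, z = (k : ℂ) * ω} := by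
      rw [h₂]
      exact ⟨0, 1, by simp⟩
    exact hω (k / l) (by rw [mul_div_mul_right _ _ hω₀]; push_cast; rfl)
end

section
/- Let u be holomorphic on a punctured neighborhood of 0 of the form u(z) = c z^{−2} + g(z) with c ∈ ℂ and g holomorphic at 0, let λ ∈ ℂ, and let φ be a function meromorphic at 0, not identically zero, satisfying −φ''(z) + u(z)φ(z) = λφ(z) on a punctured neighborhood of 0. If n ∈ ℤ denotes the order of vanishing of φ at 0 (negative if φ has a pole), then c = n(n−1). Consequently c = m(m+1) for the nonnegative integer m = max(n−1, −n). -/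
open Filter

/-- If `φ = zⁿ h` near `0` away from `0`, with `h` analytic at `0`, then
`φ' = zⁿ⁻¹ (n h + z h')` there. -/
lemma eventually_deriv_eq_zpow_sub_one_mul {φ h : ℂ → ℂ} {n : ℤ} (hh : AnalyticAt ℂ h 0)
    (hφ : ∀ᶠ z in nhdsWithin (0 : ℂ) {0}ᶜ, φ z = z ^ n * h z) :
    ∀ᶠ z in nhdsWithin (0 : ℂ) {0}ᶜ,
      deriv φ z = z ^ (n - 1) * ((n : ℂ) * h z + z * deriv h z) := by
  have hφ' : deriv φ =ᶠ[nhdsWithin (0 : ℂ) {0}ᶜ] deriv (fun z => z ^ n * h z) :=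
    EventuallyEq.nhdsNE_deriv hφ
  filter_upwards [hφ', hh.eventually_analyticAt.filter_mono nhdsWithin_le_nhds,
    self_mem_nhdsWithin] with z hz hhz hz0
  have hz0 : z ≠ 0 := hz0
  rw [hz, ((hasDerivAt_zpow n z (Or.inl hz0)).fun_mul hhz.differentiableAt.hasDerivAt).deriv,
    zpow_sub_one₀ hz0]
  field_simp

/-- let `u(z) = c z⁻² + g(z)` on a punctured neighborhood of `0`, with `g`
holomorphic at `0`, and let `φ` be meromorphic at `0`, not identically zero, with order of
vanishing `n ∈ ℤ` at `0` (i.e. `φ(z) = zⁿ h(z)` with `h` holomorphic and nonvanishing at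
`0`).  If `φ` solves `-φ'' + uφ = λφ` on a punctured neighborhood of `0`, then
`c = n(n-1)`; consequently `c = m(m+1)` for the nonnegative integer `m = max (n-1) (-n)`. -/
theorem indicial_equation_of_schrodinger_solution
    (c lam : ℂ) (g u φ h : ℂ → ℂ) (n : ℤ)
    (hg : AnalyticAt ℂ g 0)
    (hu : ∀ᶠ z in nhdsWithin (0 : ℂ) {0}ᶜ, u z = c / z ^ 2 + g z)
    (hh : AnalyticAt ℂ h 0) (hh0 : h 0 ≠ 0)
    (hφ : ∀ᶠ z in nhdsWithin (0 : ℂ) {0}ᶜ, φ z = z ^ n * h z)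
    (hode : ∀ᶠ z in nhdsWithin (0 : ℂ) {0}ᶜ,
      -(deriv (deriv φ) z) + u z * φ z = lam * φ z) :
    c = (n : ℂ) * ((n : ℂ) - 1) ∧
      c = ((max (n - 1) (-n) : ℤ) : ℂ) * (((max (n - 1) (-n) : ℤ) : ℂ) + 1) ∧
      0 ≤ max (n - 1) (-n) := by
  have hk : AnalyticAt ℂ (fun z => (n : ℂ) * h z + z * deriv h z) 0 :=
    (analyticAt_const.mul hh).add (analyticAt_id.mul hh.deriv)
  set k : ℂ → ℂ := fun z => (n : ℂ) * h z + z * deriv h z with hk_def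
  have hφ'' := eventually_deriv_eq_zpow_sub_one_mul hk
    (eventually_deriv_eq_zpow_sub_one_mul hh hφ)
  have heq : ∀ᶠ z in nhdsWithin (0 : ℂ) {0}ᶜ,
      (c + z ^ 2 * g z) * h z - (((n - 1 : ℤ) : ℂ) * k z + z * deriv k z)
        = lam * z ^ 2 * h z := by
    filter_upwards [hu, hφ, hode, hφ'', self_mem_nhdsWithin] with z huz hφz hz hz'' hz0
    have hz0 : z ≠ 0 := hz0
    rw [hz'', huz, hφz, zpow_sub_one₀ hz0, zpow_sub_one₀ hz0] at hz
    field_simp at hz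
    linear_combination hz
  have hL : ContinuousAt (fun z => (c + z ^ 2 * g z) * h z
      - (((n - 1 : ℤ) : ℂ) * k z + z * deriv k z)) 0 := by
    have := hg.continuousAt
    have := hh.continuousAt
    have := hk.continuousAt
    have := hk.deriv.continuousAt
    fun_prop
  have hR : ContinuousAt (fun z => lam * z ^ 2 * h z) 0 := by
    have := hh.continuousAt
    fun_prop
  have h0 := tendsto_nhds_unique_of_eventuallyEq (hL.tendsto.mono_left nhdsWithin_le_nhds)
    (hR.tendsto.mono_left nhdsWithin_le_nhds) heq
  have hc : c = (n : ℂ) * ((n : ℂ) - 1) := by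
    refine mul_right_cancel₀ hh0 ?_
    simp [hk_def] at h0
    linear_combination h0
  refine ⟨hc, ?_, by omega⟩
  rcases max_cases (n - 1) (-n) with ⟨hm, -⟩ | ⟨hm, -⟩ <;> rw [hm, hc] <;> push_cast <;> ring
end
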